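/- Fix an integer k > 1. For every positive integer d, the set S̃(d) is finite, and there exists a real polynomial Q of degree 2k−1 with positive leading coefficient such that the cardinality of S̃(d) is at least Q(d) for every positive integer d. In particular, there exist a constant C > 0 and a positive integer d₀ such that |S̃(d)| ≥ C·d^{2k−1} for all integers d ≥ d₀. -/

import Mathlib

/-- The set `S̃(d)` of integer points `(b₁,…,b_k,a₁,…,a_k) ∈ ℤ^{2k}` (0-indexed: `b i` is
`b_{i+1}`) satisfying the defining equality and inequalities from the paper. -/
def tildeS (k d : ℕ) : Set ((Fin k → ℤ) × (Fin k → ℤ)) :=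
  {ba | (∑ i, ba.1 i) - 2 * (∑ i, ba.2 i) = (d : ℤ)
    ∧ (∀ i j : Fin k, (j : ℕ) = (i : ℕ) + 1 →
        ((ba.1 i - ba.1 j : ℤ) : ℝ) ≥ (d : ℝ) / (2 * (k : ℝ) ^ 2))
    ∧ (∀ i : Fin k, (i : ℕ) = 0 → ((ba.1 i : ℤ) : ℝ) ≤ -((d : ℝ) / (2 * (k : ℝ) ^ 2)))
    ∧ (∀ i j : Fin k, (j : ℕ) = (i : ℕ) + 1 → 0 ≤ ba.2 i - ba.2 j)
    ∧ (∀ i : Fin k, (i : ℕ) = 0 → ba.2 i ≤ 0)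
    ∧ 0 ≤ (∑ i, ba.1 i) - (∑ i, ba.2 i)
    ∧ (∑ i, ba.1 i) - (∑ i, ba.2 i) ≤ (d : ℤ)
    ∧ (∀ v : Fin k, ba.2 v ≤ ba.1 v)}

/-- A vector whose first entry is nonpositive and whose consecutive entries do not increase is
nonpositive. -/
lemma nonpos_of_antitone_steps {k : ℕ} (f : Fin k → ℤ)
    (h0 : ∀ i : Fin k, (i : ℕ) = 0 → f i ≤ 0)
    (hs : ∀ i j : Fin k, (j : ℕ) = (i : ℕ) + 1 → 0 ≤ f i - f j) (i : Fin k) : f i ≤ 0 := by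
  obtain ⟨m, hm⟩ := i
  induction m with
  | zero => exact h0 _ rfl
  | succ m ih =>
    have h1 := ih (by omega)
    have h2 := hs ⟨m, by omega⟩ ⟨m + 1, hm⟩ rfl
    omega

lemma tildeS_finite (k d : ℕ) : (tildeS k d).Finite := by
  classical
  refine (Set.finite_Icc ((fun _ => -(d : ℤ), fun _ => -(d : ℤ)) : (Fin k → ℤ) × (Fin k → ℤ))
    (fun _ => 0, fun _ => 0)).subset ?_
  rintro ⟨b, a⟩ ⟨hsum, hbs, hb0, has, ha0, hlo, -, hab⟩
  dsimp only at *
  have hε : (0 : ℝ) ≤ (d : ℝ) / (2 * (k : ℝ) ^ 2) := by positivity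
  have ha : ∀ i, a i ≤ 0 := nonpos_of_antitone_steps a ha0 has
  have hb : ∀ i, b i ≤ 0 := by
    refine nonpos_of_antitone_steps b (fun i hi => ?_) (fun i j hij => ?_)
    · exact_mod_cast (hb0 i hi).trans (neg_nonpos.mpr hε)
    · exact_mod_cast hε.trans (hbs i j hij)
  have hlow : ∀ i, -(d : ℤ) ≤ a i := fun i => by
    have h := Finset.sum_le_sum_of_subset_of_nonneg (f := fun i => -a i)
      (Finset.subset_univ {i}) (fun j _ _ => neg_nonneg.mpr (ha j))
    simp only [Finset.sum_singleton, Finset.sum_neg_distrib] at h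
    omega
  exact ⟨⟨fun i => (hlow i).trans (hab i), hlow⟩, ⟨hb, ha⟩⟩

lemma two_mul_sum_fin_succ (n : ℕ) :
    2 * ∑ i : Fin n, ((i : ℤ) + 1) = (n : ℤ) * (n + 1) := by
  induction n with
  | zero => simp
  | succ n ih =>
    rw [Fin.sum_univ_castSucc, mul_add]
    simp only [Fin.val_castSucc, Fin.val_last]
    rw [ih]
    push_cast
    ring

/-- The `a`-coordinates of the lattice points filling a box inside `tildeS k d`, at scale `N`. -/
def boxA (k N : ℕ) (x : Fin k → ℤ) : Fin k → ℤ :=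
  fun i => x i - (8 * k * ((i : ℤ) + 1) + 2 * k * (k - 1)) * N

/-- The `b`-coordinates of the lattice points filling a box inside `tildeS (n + 1) d`, at scale
`N`; the first coordinate is forced by the equality defining `tildeS`. -/
def boxB (n d N : ℕ) (x : Fin (n + 1) → ℤ) (y : Fin n → ℤ) : Fin (n + 1) → ℤ :=
  Fin.cons
    (d - 8 * (n + 1) ^ 3 * N - 8 * (n + 1) * N + 2 * ∑ i, x i - ∑ j, y j)
    (fun j => y j - 8 * (n + 1) * ((j : ℤ) + 2) * N)

lemma sum_boxB_sub_two_mul_sum_boxA (n d N : ℕ) (x : Fin (n + 1) → ℤ) (y : Fin n → ℤ) :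
    ∑ i, boxB n d N x y i - 2 * ∑ i, boxA (n + 1) N x i = d := by
  have h1 := two_mul_sum_fin_succ (n + 1)
  have h2 : ∑ i : Fin (n + 1), ((i : ℤ) + 1) = 1 + ∑ j : Fin n, ((j : ℤ) + 2) := by
    rw [Fin.sum_univ_succ]
    congr 1
  simp only [boxA, boxB, Fin.sum_univ_succ (fun i => (Fin.cons _ _ : Fin (n + 1) → ℤ) i),
    Fin.cons_zero, Fin.cons_succ, Finset.sum_sub_distrib, ← Finset.sum_mul, ← Finset.mul_sum,
    Finset.sum_add_distrib (f := fun i : Fin (n + 1) => 8 * ((n + 1 : ℕ) : ℤ) * ((i : ℤ) + 1)),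
    Finset.sum_const, Finset.card_univ, Fintype.card_fin, nsmul_eq_mul]
  rw [h2] at h1 ⊢
  push_cast at h1 ⊢
  linear_combination (4 * ((n : ℤ) + 1) * N) * h1

lemma box_mem_tildeS {n d N : ℕ} (hn : 1 ≤ n) (hlo : 8 * (n + 1) ^ 3 * N ≤ d)
    (hhi : d ≤ 8 * (n + 1) ^ 3 * N + N) {x : Fin (n + 1) → ℤ} {y : Fin n → ℤ}
    (hx : ∀ i, 0 ≤ x i ∧ x i ≤ N) (hy : ∀ j, 0 ≤ y j ∧ y j ≤ N) :
    (boxB n d N x y, boxA (n + 1) N x) ∈ tildeS (n + 1) d := by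
  have hsum := sum_boxB_sub_two_mul_sum_boxA n d N x y
  have hε : (d : ℝ) / (2 * ((n + 1 : ℕ) : ℝ) ^ 2) ≤ (((4 * (n + 1) + 1) * N : ℤ) : ℝ) := by
    rw [div_le_iff₀ (by positivity)]
    have : d ≤ (4 * (n + 1) + 1) * N * (2 * (n + 1) ^ 2) := by nlinarith [sq_nonneg n]
    exact_mod_cast this
  have hlo' : 8 * ((n : ℤ) + 1) ^ 3 * N ≤ d := by exact_mod_cast hlo
  have hhi' : (d : ℤ) ≤ 8 * ((n : ℤ) + 1) ^ 3 * N + N := by exact_mod_cast hhi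
  have hn' : (1 : ℤ) ≤ n := by exact_mod_cast hn
  have hN : (0 : ℤ) ≤ N := by positivity
  have hnN : (N : ℤ) ≤ n * N := by nlinarith
  have hnnN : (n : ℤ) * N ≤ n * n * N := by nlinarith
  have hX0 : 0 ≤ ∑ i, x i := Finset.sum_nonneg fun i _ => (hx i).1
  have hX1 : ∑ i, x i ≤ (n + 1) * N := by
    simpa using Finset.sum_le_sum fun i (_ : i ∈ Finset.univ) => (hx i).2
  have hY0 : 0 ≤ ∑ j, y j := Finset.sum_nonneg fun j _ => (hy j).1
  have hY1 : ∑ j, y j ≤ n * N := by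
    simpa using Finset.sum_le_sum fun j (_ : j ∈ Finset.univ) => (hy j).2
  have hstepA : ∀ i j : Fin (n + 1), (j : ℕ) = (i : ℕ) + 1 →
      0 ≤ boxA (n + 1) N x i - boxA (n + 1) N x j := fun i j hij => by
    have h1 := hx i
    have h2 := hx j
    simp only [boxA, hij]
    push_cast
    linarith
  have hfirstA : ∀ i : Fin (n + 1), (i : ℕ) = 0 → boxA (n + 1) N x i ≤ 0 := fun i hi => by
    have h1 := hx i
    simp only [boxA, hi]
    push_cast
    linarith
  have hAB : ∀ i, boxA (n + 1) N x i ≤ boxB n d N x y i := fun i => by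
    refine Fin.cases ?_ (fun j => ?_) i
    · have h1 := hx 0
      simp only [boxA, boxB, Fin.cons_zero, Fin.val_zero]
      push_cast
      linarith
    · have h1 := hx j.succ
      have h2 := hy j
      simp only [boxA, boxB, Fin.cons_succ, Fin.val_succ]
      push_cast
      linarith
  have hA : ∑ i, boxA (n + 1) N x i ≤ 0 :=
    Finset.sum_nonpos fun i _ => nonpos_of_antitone_steps _ hfirstA hstepA i
  refine ⟨hsum, fun i j hij => hε.trans (Int.cast_le.mpr ?_), fun i hi => ?_, hstepA, hfirstA,
    sub_nonneg.mpr (Finset.sum_le_sum fun i _ => hAB i), by dsimp only; linarith, hAB⟩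
  · obtain ⟨j, rfl⟩ := Fin.exists_succ_eq.mpr (show j ≠ 0 by rintro rfl; simp at hij)
    have h2 := hy j
    rcases Fin.eq_zero_or_eq_succ i with rfl | ⟨i, rfl⟩
    · have hj : (j : ℕ) = 0 := by simpa using hij
      simp only [boxB, Fin.cons_zero, Fin.cons_succ, hj]
      push_cast
      linarith
    · have hj : (j : ℕ) = (i : ℕ) + 1 := by simpa using hij
      have h1 := hy i
      simp only [boxB, Fin.cons_succ, hj]
      push_cast
      linarith
  · obtain rfl : i = 0 := Fin.ext hi
    refine le_trans ?_ (neg_le_neg hε)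
    rw [← Int.cast_neg]
    refine Int.cast_le.mpr ?_
    simp only [boxB, Fin.cons_zero]
    linarith

lemma pow_le_ncard_tildeS {n d N : ℕ} (hn : 1 ≤ n) (hlo : 8 * (n + 1) ^ 3 * N ≤ d)
    (hhi : d ≤ 8 * (n + 1) ^ 3 * N + N) : N ^ (2 * n + 1) ≤ (tildeS (n + 1) d).ncard := by
  have : Finite (tildeS (n + 1) d) := tildeS_finite (n + 1) d
  let f : (Fin (n + 1) → Fin N) × (Fin n → Fin N) → tildeS (n + 1) d := fun p =>
    ⟨(boxB n d N (fun i => ((p.1 i : ℕ) : ℤ)) (fun j => ((p.2 j : ℕ) : ℤ)),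
      boxA (n + 1) N (fun i => ((p.1 i : ℕ) : ℤ))),
      box_mem_tildeS hn hlo hhi (fun i => ⟨by positivity, by exact_mod_cast (p.1 i).2.le⟩)
        (fun j => ⟨by positivity, by exact_mod_cast (p.2 j).2.le⟩)⟩
  have hf : Function.Injective f := by
    rintro ⟨x, y⟩ ⟨x', y'⟩ h
    obtain ⟨hb, ha⟩ := Prod.ext_iff.mp (Subtype.ext_iff.mp h)
    refine Prod.ext (funext fun i => ?_) (funext fun j => ?_)
    · have := congrFun ha i
      simp only [f, boxA, sub_left_inj] at this
      exact Fin.ext (by exact_mod_cast this)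
    · have := congrFun hb j.succ
      simp only [f, boxB, Fin.cons_succ, sub_left_inj] at this
      exact Fin.ext (by exact_mod_cast this)
  have h := Nat.card_le_card_of_injective f hf
  rw [Nat.card_coe_set_eq] at h
  refine le_of_eq_of_le ?_ h
  simp only [Nat.card_eq_fintype_card, Fintype.card_prod, Fintype.card_fun, Fintype.card_fin]
  ring

lemma exists_mul_pow_le_ncard_tildeS (k : ℕ) (hk : 1 < k) :
    ∃ C : ℝ, 0 < C ∧ ∃ d₀ : ℕ, 0 < d₀ ∧ ∀ d : ℕ, d₀ ≤ d →
      C * (d : ℝ) ^ (2 * k - 1) ≤ ((tildeS k d).ncard : ℝ) := by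
  obtain ⟨n, rfl⟩ : ∃ n, k = n + 1 := ⟨k - 1, by omega⟩
  obtain ⟨M, hM⟩ : ∃ M, M = 8 * (n + 1) ^ 3 := ⟨_, rfl⟩
  have hM0 : 0 < M := by rw [hM]; positivity
  have hMR : (0 : ℝ) < M := by exact_mod_cast hM0
  refine ⟨(1 / (2 * M)) ^ (2 * n + 1), by positivity, M * M, by positivity, fun d hd => ?_⟩
  obtain ⟨N, hN⟩ : ∃ N, N = d / M := ⟨_, rfl⟩
  have hMN : M ≤ N := hN ▸ (Nat.le_div_iff_mul_le hM0).mpr hd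
  have hlo : M * N ≤ d := hN ▸ Nat.mul_div_le d M
  have hlt : d < M * N + M := by
    have := Nat.lt_mul_div_succ d hM0
    rwa [← hN, mul_add, mul_one] at this
  have hcard := pow_le_ncard_tildeS (n := n) (d := d) (N := N) (by omega) (hM ▸ hlo)
    (by rw [← hM]; omega)
  have hdN : (1 / (2 * M) : ℝ) * d ≤ N := by
    rw [one_div_mul_eq_div, div_le_iff₀ (by positivity)]
    have : d ≤ N * (2 * M) := by nlinarith
    exact_mod_cast this
  rw [show 2 * (n + 1) - 1 = 2 * n + 1 by omega, ← mul_pow]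
  calc ((1 / (2 * M) : ℝ) * d) ^ (2 * n + 1) ≤ (N : ℝ) ^ (2 * n + 1) := by gcongr
    _ ≤ _ := by exact_mod_cast hcard

/-- For fixed `k > 1`: each `S̃(d)` is finite, there is a real polynomial `Q` of degree
`2k-1` with positive leading coefficient with `|S̃(d)| ≥ Q(d)` for all positive integers `d`,
and in particular there are `C > 0` and `d₀` with `|S̃(d)| ≥ C d^{2k-1}` for `d ≥ d₀`. -/
theorem tildeS_card_lower_bound (k : ℕ) (hk : 1 < k) :
    (∀ d : ℕ, 0 < d → (tildeS k d).Finite) ∧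
    (∃ Q : Polynomial ℝ, Q.degree = ((2 * k - 1 : ℕ) : WithBot ℕ) ∧ 0 < Q.leadingCoeff ∧
      ∀ d : ℕ, 0 < d → Q.eval (d : ℝ) ≤ ((tildeS k d).ncard : ℝ)) ∧
    (∃ C : ℝ, 0 < C ∧ ∃ d₀ : ℕ, 0 < d₀ ∧ ∀ d : ℕ, d₀ ≤ d →
      C * (d : ℝ) ^ (2 * k - 1) ≤ ((tildeS k d).ncard : ℝ)) := by
  have hmain := exists_mul_pow_le_ncard_tildeS k hk
  refine ⟨fun d _ => tildeS_finite k d, ?_, hmain⟩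
  obtain ⟨C, hC, d₀, -, h⟩ := hmain
  have hdeg : 0 < 2 * k - 1 := by omega
  refine ⟨Polynomial.C C * Polynomial.X ^ (2 * k - 1) -
    Polynomial.C (C * (d₀ : ℝ) ^ (2 * k - 1)), ?_, ?_, fun d _ => ?_⟩
  · rw [Polynomial.degree_sub_C, Polynomial.degree_C_mul_X_pow _ hC.ne']
    rw [Polynomial.degree_C_mul_X_pow _ hC.ne']
    exact_mod_cast hdeg
  · rw [Polynomial.leadingCoeff_sub_of_degree_lt, Polynomial.leadingCoeff_C_mul_X_pow]
    · exact hC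
    · rw [Polynomial.degree_C_mul_X_pow _ hC.ne']
      exact Polynomial.degree_C_le.trans_lt (by exact_mod_cast hdeg)
  · simp only [Polynomial.eval_sub, Polynomial.eval_mul, Polynomial.eval_C, Polynomial.eval_pow,
      Polynomial.eval_X]
    rcases le_total d₀ d with hd | hd
    · exact (sub_le_self _ (by positivity)).trans (h d hd)
    · refine le_trans (sub_nonpos.mpr ?_) (Nat.cast_nonneg _)
      gcongr
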